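/- Let 0 < p < 1/2 (asymmetric simple random walk with downward drift). Then E((M_n^+)^2) → p/(1 - 2p)^2 as n → ∞. -/

import Mathlib

open Finset Filter

/-- The value `±1` of a single step of the walk, driven by a Boolean. -/
def step (b : Bool) : ℤ := if b then 1 else -1

/-- The partial sum `S_j = X_1 + ⋯ + X_j` of the simple random walk driven by `ω`. -/
def walk {n : ℕ} (ω : Fin n → Bool) (j : ℕ) : ℤ :=
  ∑ i ∈ Finset.univ.filter fun i : Fin n => (i : ℕ) < j, step (ω i)

/-- `M_n^+ = max_{0 ≤ j ≤ n} S_j`. -/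
def mplus {n : ℕ} (ω : Fin n → Bool) : ℤ :=
  (Finset.range (n + 1)).sup' (by simp) (walk ω)

/-- `M_n^- = -min_{0 ≤ j ≤ n} S_j`. -/
def mminus {n : ℕ} (ω : Fin n → Bool) : ℤ :=
  -((Finset.range (n + 1)).inf' (by simp) (walk ω))

/-- The probability weight of the path `ω` when `P{Xᵢ = 1} = p`, `P{Xᵢ = -1} = 1 - p`,
independently over `i`. -/
def wt (p : ℝ) {n : ℕ} (ω : Fin n → Bool) : ℝ :=
  ∏ i, if ω i then p else 1 - p

/-- The probability of an event `A` for a walk of length `n`. -/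
noncomputable def prob (p : ℝ) {n : ℕ} (A : Set (Fin n → Bool)) : ℝ :=
  ∑ ω : Fin n → Bool, A.indicator (wt p) ω

/-- The expectation of a functional `f` of a walk of length `n`. -/
noncomputable def expectation (p : ℝ) {n : ℕ} (f : (Fin n → Bool) → ℝ) : ℝ :=
  ∑ ω : Fin n → Bool, wt p ω * f ω

lemma walk_zero {n : ℕ} (ω : Fin n → Bool) : walk ω 0 = 0 := by
  simp [walk]

lemma walk_cons_succ {n : ℕ} (b : Bool) (ω : Fin n → Bool) (j : ℕ) :
    walk (Fin.cons b ω : Fin (n + 1) → Bool) (j + 1) = step b + walk ω j := by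
  simp [walk, Finset.sum_filter, Fin.sum_univ_succ]

lemma mplus_zero (ω : Fin 0 → Bool) : mplus ω = 0 := by
  simp [mplus, walk]

lemma mplus_cons {n : ℕ} (b : Bool) (ω : Fin n → Bool) :
    mplus (Fin.cons b ω : Fin (n + 1) → Bool) = max 0 (step b + mplus ω) := by
  refine eq_of_forall_ge_iff fun c => ?_
  have h : step b + mplus ω ≤ c ↔ ∀ j < n + 1, step b + walk ω j ≤ c := by
    rw [← le_sub_iff_add_le', mplus, Finset.sup'_le_iff]
    simp only [Finset.mem_range, le_sub_iff_add_le']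
  rw [max_le_iff, h, mplus, Finset.sup'_le_iff]
  simp only [Finset.mem_range]
  constructor
  · intro H
    refine ⟨by simpa [walk_zero] using H 0 (by omega), fun j hj => ?_⟩
    rw [← walk_cons_succ]
    exact H (j + 1) (by omega)
  · rintro ⟨h0, H⟩ (_ | j) hj
    · simpa [walk_zero] using h0
    · rw [walk_cons_succ]
      exact H j (by omega)

lemma mplus_nonneg {n : ℕ} (ω : Fin n → Bool) : 0 ≤ mplus ω := by
  rw [← walk_zero ω]
  exact Finset.le_sup' (walk ω) (by simp)

lemma mplus_le {n : ℕ} (ω : Fin n → Bool) : mplus ω ≤ n := by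
  induction n with
  | zero => simp [mplus_zero]
  | succ n ih =>
    rw [← Fin.cons_self_tail ω, mplus_cons]
    have h := ih (Fin.tail ω)
    have hs : step (ω 0) ≤ 1 := by unfold step; split <;> norm_num
    push_cast
    omega

lemma expectation_succ (p : ℝ) {n : ℕ} (f : (Fin (n + 1) → Bool) → ℝ) :
    expectation p f = p * expectation p (fun ω : Fin n → Bool => f (Fin.cons true ω)) +
      (1 - p) * expectation p (fun ω : Fin n → Bool => f (Fin.cons false ω)) := by
  unfold expectation
  rw [← (Fin.consEquiv fun _ : Fin (n + 1) => Bool).sum_comp, Fintype.sum_prod_type,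
    Fintype.sum_bool, Finset.mul_sum, Finset.mul_sum]
  simp [Fin.consEquiv, wt, Fin.prod_univ_succ, mul_assoc]

lemma expectation_one (p : ℝ) (n : ℕ) : expectation p (fun _ : Fin n → Bool => 1) = 1 := by
  induction n with
  | zero => simp [expectation, wt]
  | succ n ih => rw [expectation_succ, ih]; ring

/-- The tail probability `P{M_n^+ ≥ k}`. -/
noncomputable def mplusTail (p : ℝ) (n k : ℕ) : ℝ :=
  expectation p (fun ω : Fin n → Bool => if (k : ℤ) ≤ mplus ω then 1 else 0)

lemma mplusTail_zero_right (p : ℝ) (n : ℕ) : mplusTail p n 0 = 1 := by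
  simpa [mplusTail, mplus_nonneg] using expectation_one p n

lemma mplusTail_zero_succ (p : ℝ) (k : ℕ) : mplusTail p 0 (k + 1) = 0 := by
  have h : ¬ (k : ℤ) + 1 ≤ 0 := by omega
  simp [mplusTail, expectation, mplus_zero, h]

lemma mplusTail_succ_succ (p : ℝ) (n k : ℕ) :
    mplusTail p (n + 1) (k + 1) = p * mplusTail p n k + (1 - p) * mplusTail p n (k + 2) := by
  have hu (m : ℤ) : ((k + 1 : ℕ) : ℤ) ≤ max 0 (step true + m) ↔ (k : ℤ) ≤ m := by
    simp only [step, if_true]; omega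
  have hd (m : ℤ) : ((k + 1 : ℕ) : ℤ) ≤ max 0 (step false + m) ↔ ((k + 2 : ℕ) : ℤ) ≤ m := by
    simp only [step]; grind
  unfold mplusTail
  rw [expectation_succ]
  simp only [mplus_cons, hu, hd]

lemma mplusTail_eq_zero (p : ℝ) {n k : ℕ} (h : n < k) : mplusTail p n k = 0 := by
  have H (ω : Fin n → Bool) : ¬ (k : ℤ) ≤ mplus ω := by
    have := mplus_le ω
    omega
  simp [mplusTail, expectation, H]

lemma mplusTail_nonneg {p : ℝ} (hp0 : 0 ≤ p) (hp1 : p ≤ 1) (n k : ℕ) : 0 ≤ mplusTail p n k := by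
  refine Finset.sum_nonneg fun ω _ => mul_nonneg (Finset.prod_nonneg fun i _ => ?_) ?_
  · split <;> linarith
  · dsimp only
    split <;> norm_num

lemma mplusTail_le_pow {p r : ℝ} (hp0 : 0 ≤ p) (hp1 : p ≤ 1) (hr0 : 0 ≤ r)
    (hr : p + (1 - p) * r ^ 2 = r) (n k : ℕ) : mplusTail p n k ≤ r ^ k := by
  induction n generalizing k with
  | zero =>
    cases k with
    | zero => simp [mplusTail_zero_right]
    | succ k => rw [mplusTail_zero_succ]; positivity
  | succ n ih =>
    cases k with
    | zero => simp [mplusTail_zero_right]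
    | succ k =>
      have hq : 0 ≤ 1 - p := by linarith
      calc mplusTail p (n + 1) (k + 1)
          = p * mplusTail p n k + (1 - p) * mplusTail p n (k + 2) := mplusTail_succ_succ p n k
        _ ≤ p * r ^ k + (1 - p) * r ^ (k + 2) := by
          gcongr
          · exact ih k
          · exact ih (k + 2)
        _ = (p + (1 - p) * r ^ 2) * r ^ k := by ring
        _ = r ^ (k + 1) := by rw [hr]; ring

lemma pow_sub_le_mplusTail {p r s l : ℝ} (hp0 : 0 ≤ p) (hp1 : p ≤ 1) (hr0 : 0 ≤ r)
    (hr : p + (1 - p) * r ^ 2 = r) (hrs : r ≤ s) (hl0 : 0 ≤ l)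
    (hl : p + (1 - p) * s ^ 2 = l * s) (n k : ℕ) :
    r ^ k - l ^ n * s ^ k ≤ mplusTail p n k := by
  have hs : 0 ≤ s := hr0.trans hrs
  induction n generalizing k with
  | zero =>
    have h : r ^ k - l ^ 0 * s ^ k ≤ 0 := by
      have := pow_le_pow_left₀ hr0 hrs k
      simpa using this
    exact h.trans (mplusTail_nonneg hp0 hp1 0 k)
  | succ n ih =>
    cases k with
    | zero =>
      rw [mplusTail_zero_right]
      have : 0 ≤ l ^ (n + 1) := by positivity
      simpa using this
    | succ k =>
      have hq : 0 ≤ 1 - p := by linarith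
      calc r ^ (k + 1) - l ^ (n + 1) * s ^ (k + 1)
          = r * r ^ k - l ^ n * (l * s) * s ^ k := by ring
        _ = (p + (1 - p) * r ^ 2) * r ^ k - l ^ n * (p + (1 - p) * s ^ 2) * s ^ k := by
          rw [hr, hl]
        _ = p * (r ^ k - l ^ n * s ^ k) +
            (1 - p) * (r ^ (k + 2) - l ^ n * s ^ (k + 2)) := by ring
        _ ≤ p * mplusTail p n k + (1 - p) * mplusTail p n (k + 2) := by
          gcongr
          · exact ih k
          · exact ih (k + 2)
        _ = mplusTail p (n + 1) (k + 1) := (mplusTail_succ_succ p n k).symm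

lemma tendsto_mplusTail {p : ℝ} (hp0 : 0 < p) (hp1 : p < 1 / 2) (k : ℕ) :
    Tendsto (fun n => mplusTail p n k) atTop (nhds ((p / (1 - p)) ^ k)) := by
  have hq : 0 < 1 - p := by linarith
  have hr0 : 0 < p / (1 - p) := by positivity
  have hr1 : p / (1 - p) < 1 := by rw [div_lt_one hq]; linarith
  have hr : p + (1 - p) * (p / (1 - p)) ^ 2 = p / (1 - p) := by field_simp; ring
  obtain ⟨s, hrs, hs1⟩ := exists_between hr1
  have hs0 : 0 < s := hr0.trans hrs
  have hps : p < s * (1 - p) := (div_lt_iff₀ hq).1 hrs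
  have hl0 : 0 ≤ (p + (1 - p) * s ^ 2) / s := by positivity
  have hl1 : (p + (1 - p) * s ^ 2) / s < 1 := by
    rw [div_lt_one hs0]
    nlinarith [mul_pos (sub_pos.2 hps) (sub_pos.2 hs1)]
  have hlow : Tendsto (fun n : ℕ => (p / (1 - p)) ^ k - ((p + (1 - p) * s ^ 2) / s) ^ n * s ^ k)
      atTop (nhds ((p / (1 - p)) ^ k)) := by
    simpa using ((tendsto_pow_atTop_nhds_zero_of_lt_one hl0 hl1).mul_const (s ^ k)).const_sub
      ((p / (1 - p)) ^ k)
  exact tendsto_of_tendsto_of_tendsto_of_le_of_le hlow tendsto_const_nhds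
    (fun n => pow_sub_le_mplusTail hp0.le (by linarith) hr0.le hr hrs.le hl0
      (by field_simp) n k)
    (fun n => mplusTail_le_pow hp0.le (by linarith) hr0.le hr n k)

lemma sum_range_odd_ite_eq_sq {m n : ℕ} (h : m ≤ n) :
    ∑ k ∈ Finset.range n, (2 * (k : ℝ) + 1) * (if ((k + 1 : ℕ) : ℤ) ≤ m then 1 else 0) =
      (m : ℝ) ^ 2 := by
  induction n, h using Nat.le_induction with
  | base =>
    have hodd (j : ℕ) : ∑ k ∈ Finset.range j, (2 * (k : ℝ) + 1) = (j : ℝ) ^ 2 := by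
      induction j with
      | zero => simp
      | succ j ih => rw [Finset.sum_range_succ, ih]; push_cast; ring
    rw [← hodd m]
    refine Finset.sum_congr rfl fun k hk => ?_
    rw [if_pos (by have := Finset.mem_range.1 hk; omega), mul_one]
  | succ n hn ih => rw [Finset.sum_range_succ, ih, if_neg (by omega)]; ring

lemma expectation_mplus_sq (p : ℝ) (n : ℕ) :
    expectation p (fun ω : Fin n → Bool => ((mplus ω : ℝ)) ^ 2) =
      ∑' k : ℕ, (2 * (k : ℝ) + 1) * mplusTail p n (k + 1) := by
  rw [tsum_eq_sum (s := Finset.range n) fun k hk => by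
    rw [mplusTail_eq_zero p (by have := mt Finset.mem_range.2 hk; omega), mul_zero]]
  simp only [mplusTail, expectation, Finset.mul_sum]
  rw [Finset.sum_comm]
  refine Finset.sum_congr rfl fun ω _ => ?_
  obtain ⟨m, hm⟩ := Int.eq_ofNat_of_zero_le (mplus_nonneg ω)
  have hmn : m ≤ n := by have := mplus_le ω; omega
  rw [hm, Int.cast_natCast, ← sum_range_odd_ite_eq_sq hmn, Finset.mul_sum]
  exact Finset.sum_congr rfl fun k _ => by ring

lemma hasSum_odd_mul_geometric {r : ℝ} (hr0 : 0 ≤ r) (hr1 : r < 1) :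
    HasSum (fun k : ℕ => (2 * (k : ℝ) + 1) * r ^ (k + 1)) (r * (1 + r) / (1 - r) ^ 2) := by
  have hn : ‖r‖ < 1 := by rwa [Real.norm_of_nonneg hr0]
  have h1 : (1 - r) ≠ 0 := by linarith
  have h := ((hasSum_coe_mul_geometric_of_norm_lt_one hn).mul_left (2 * r)).add
    ((hasSum_geometric_of_norm_lt_one hn).mul_left r)
  have hval : r * (1 + r) / (1 - r) ^ 2 = 2 * r * (r / (1 - r) ^ 2) + r * (1 - r)⁻¹ := by
    field_simp
    ring
  have hterm : (fun k : ℕ => (2 * (k : ℝ) + 1) * r ^ (k + 1)) =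
      fun k : ℕ => 2 * r * ((k : ℝ) * r ^ k) + r * r ^ k := by
    funext k
    ring
  rw [hval, hterm]
  exact h

theorem statement6 (p : ℝ) (hp0 : 0 < p) (hp1 : p < 1/2) :
    Tendsto (fun n : ℕ => expectation p (fun ω : Fin n → Bool => ((mplus ω : ℝ)) ^ 2))
      atTop (nhds (p / (1 - 2 * p) ^ 2)) := by
  have hq : 0 < 1 - p := by linarith
  have hr0 : 0 ≤ p / (1 - p) := by positivity
  have hr1 : p / (1 - p) < 1 := by rw [div_lt_one hq]; linarith
  have hr : p + (1 - p) * (p / (1 - p)) ^ 2 = p / (1 - p) := by field_simp; ring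
  have hsum := hasSum_odd_mul_geometric hr0 hr1
  have hval : p / (1 - 2 * p) ^ 2 =
      p / (1 - p) * (1 + p / (1 - p)) / (1 - p / (1 - p)) ^ 2 := by
    have h2 : 1 - 2 * p ≠ 0 := by linarith
    have h3 : 1 - p / (1 - p) = (1 - 2 * p) / (1 - p) := by field_simp; ring
    rw [h3]
    field_simp
    ring
  rw [hval, ← hsum.tsum_eq]
  simp only [expectation_mplus_sq]
  refine tendsto_tsum_of_dominated_convergence hsum.summable
    (fun k => (tendsto_mplusTail hp0 hp1 (k + 1)).const_mul _)
    (Eventually.of_forall fun n k => ?_)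
  have h0 := mplusTail_nonneg hp0.le (by linarith) n (k + 1)
  rw [Real.norm_of_nonneg (by positivity)]
  gcongr
  exact mplusTail_le_pow hp0.le (by linarith) hr0 hr n (k + 1)
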